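/- Let L be a Lie Λ-torus of type Δ with root lattice Q, let s ∈ Hom(Q,Λ), and let Π be a base for Δ. The following are equivalent: (a) the shifted Q×Λ-graded algebra L^(s) with (L^(s))_α^λ = L_α^{λ+s(α)} is again a Lie Λ-torus; (b) s(α) ∈ Λ_α for all indivisible nonzero α ∈ Δ; (c) s(α) ∈ Λ_α for all α ∈ Π. -/

import Mathlib

/-- `f` is a coroot functional for `α` with respect to the set `Δ`. -/
def IsCoroot {k 𝒳 : Type*} [Field k] [AddCommGroup 𝒳] [Module k 𝒳]
    (Δ : Set 𝒳) (α : 𝒳) (f : Module.Dual k 𝒳) : Prop :=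
  f α = 2 ∧ ∀ β ∈ Δ, β - f β • α ∈ Δ

/-- A finite irreducible root system (containing `0`) in `𝒳`, together with a choice of
coroot functional for each nonzero root. -/
structure RootSystemIn (k 𝒳 : Type*) [Field k] [AddCommGroup 𝒳] [Module k 𝒳] where
  Δ : Set 𝒳
  coroot : 𝒳 → Module.Dual k 𝒳
  finite : Δ.Finite
  zero_mem : (0 : 𝒳) ∈ Δ
  span_eq : Submodule.span k Δ = ⊤
  isCoroot : ∀ α ∈ Δ, α ≠ 0 → IsCoroot Δ α (coroot α)
  pairing_int : ∀ α ∈ Δ, α ≠ 0 → ∀ β ∈ Δ, ∃ z : ℤ, coroot α β = (z : k)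
  irreducible : ∀ A B : Set 𝒳, A ∪ B = Δ \ {0} → A ∩ B = ∅ →
    (∀ α ∈ A, ∀ β ∈ B, coroot β α = 0) → A = ∅ ∨ B = ∅

/-- A Lie `Λ`-torus of type `Δ`: a `Q × Λ`-graded Lie algebra (the grading being recorded
by the family `g` of subspaces indexed by `𝒳 × Λ`, supported on `Δ`) satisfying the axioms
(LT1)–(LT4). -/
structure IsLieTorus {k 𝒳 Λ L : Type*} [Field k] [AddCommGroup 𝒳] [Module k 𝒳]
    [DecidableEq 𝒳] [AddCommGroup Λ] [DecidableEq Λ] [LieRing L] [LieAlgebra k L]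
    (R : RootSystemIn k 𝒳) (g : 𝒳 → Λ → Submodule k L) : Prop where
  isInternal : DirectSum.IsInternal fun p : 𝒳 × Λ => g p.1 p.2
  bracket_mem : ∀ (α β : 𝒳) (lam mu : Λ), ∀ x ∈ g α lam, ∀ y ∈ g β mu,
    ⁅x, y⁆ ∈ g (α + β) (lam + mu)
  supp_subset : ∀ (α : 𝒳) (lam : Λ), g α lam ≠ ⊥ → α ∈ R.Δ
  lt2i : ∀ α ∈ R.Δ, α ≠ 0 → (¬ ∃ γ ∈ R.Δ, α = (2 : k) • γ) → g α 0 ≠ ⊥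
  lt2ii : ∀ (α : 𝒳) (lam : Λ), α ≠ 0 → g α lam ≠ ⊥ →
    ∃ e f : L, e ∈ g α lam ∧ f ∈ g (-α) (-lam) ∧
      g α lam = Submodule.span k {e} ∧ g (-α) (-lam) = Submodule.span k {f} ∧
      ∀ (β : 𝒳) (mu : Λ), ∀ x ∈ g β mu, ⁅⁅e, f⁆, x⁆ = R.coroot α β • x
  lt3 : LieSubalgebra.lieSpan k L
    (⋃ α ∈ R.Δ \ {0}, ⋃ lam : Λ, (g α lam : Set L)) = ⊤
  lt4 : AddSubgroup.closure {lam : Λ | ∃ α : 𝒳, g α lam ≠ ⊥} = ⊤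

section
variable {k 𝒳 Λ L : Type*} [Field k] [CharZero k] [AddCommGroup 𝒳] [Module k 𝒳]
  [DecidableEq 𝒳] [AddCommGroup Λ] [DecidableEq Λ] [LieRing L] [LieAlgebra k L]

open Classical in
/-- The grading of the isotope `L^(s)`: `(L^(s))_α^λ = L_α^{λ + s(α)}`, for
`s ∈ Hom(Q, Λ)` where `Q = ⟨Δ⟩` is the root lattice. -/
noncomputable def isoGrading (R : RootSystemIn k 𝒳) (g : 𝒳 → Λ → Submodule k L)
    (s : ↥(AddSubgroup.closure R.Δ) →+ Λ) : 𝒳 → Λ → Submodule k L :=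
  fun α lam =>
    if h : α ∈ AddSubgroup.closure R.Δ then g α (lam + s ⟨α, h⟩) else ⊥

/-- `s ∈ Hom(Q, Λ)` is admissible for the Lie torus `L`:
`s(α) ∈ Λ_α` for every indivisible nonzero root `α`. -/
def Admissible (R : RootSystemIn k 𝒳) (g : 𝒳 → Λ → Submodule k L)
    (s : ↥(AddSubgroup.closure R.Δ) →+ Λ) : Prop :=
  ∀ α, ∀ hα : α ∈ R.Δ, α ≠ 0 → (¬ ∃ γ ∈ R.Δ, α = (2 : k) • γ) →
    g α (s ⟨α, AddSubgroup.subset_closure hα⟩) ≠ ⊥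

/-- A base `Π` of the root system `Δ`. -/
def IsBase (R : RootSystemIn k 𝒳) (Pi : Finset 𝒳) : Prop :=
  (↑Pi : Set 𝒳) ⊆ R.Δ \ {0} ∧
  LinearIndependent k (fun x : (Pi : Set 𝒳) => (x : 𝒳)) ∧
  ∀ β ∈ R.Δ, ∃ c : 𝒳 → ℤ,
    ((∀ α ∈ Pi, 0 ≤ c α) ∨ (∀ α ∈ Pi, c α ≤ 0)) ∧ β = ∑ α ∈ Pi, c α • α

theorem aux_refl_mem (R : RootSystemIn k 𝒳) {α β : 𝒳} (hα : α ∈ R.Δ) (h0 : α ≠ 0)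
    (hβ : β ∈ R.Δ) : β - R.coroot α β • α ∈ R.Δ :=
  (R.isCoroot α hα h0).2 β hβ

theorem aux_self (R : RootSystemIn k 𝒳) {α : 𝒳} (hα : α ∈ R.Δ) (h0 : α ≠ 0) :
    R.coroot α α = 2 := (R.isCoroot α hα h0).1

theorem aux_neg_mem (R : RootSystemIn k 𝒳) {α : 𝒳} (hα : α ∈ R.Δ) (h0 : α ≠ 0) :
    -α ∈ R.Δ := by
  have h := (R.isCoroot α hα h0).2 α hα
  rw [(R.isCoroot α hα h0).1, two_smul] at h
  simpa using h

theorem aux_invol (R : RootSystemIn k 𝒳) {α : 𝒳} (hα : α ∈ R.Δ) (h0 : α ≠ 0) (x : 𝒳) :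
    (x - R.coroot α x • α) - R.coroot α (x - R.coroot α x • α) • α = x := by
  rw [map_sub, map_smul, aux_self R hα h0, smul_eq_mul]
  module

theorem aux_refl_ne (R : RootSystemIn k 𝒳) {α β : 𝒳} (hα : α ∈ R.Δ) (h0 : α ≠ 0)
    (hβ : β ≠ 0) : β - R.coroot α β • α ≠ 0 := by
  intro h
  have := aux_invol R hα h0 β
  rw [h] at this
  simp at this
  exact hβ this.symm

theorem aux_coroot_refl (R : RootSystemIn k 𝒳) {α γ : 𝒳} (hα : α ∈ R.Δ) (h0 : α ≠ 0)
    (hγ : γ ∈ R.Δ) (g0 : γ ≠ 0) (x : 𝒳) :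
    R.coroot (γ - R.coroot α γ • α) x = R.coroot γ (x - R.coroot α x • α) := by
  have hm := aux_refl_mem R hα h0 hγ
  have hn := aux_refl_ne R hα h0 g0
  have key : R.coroot (γ - R.coroot α γ • α)
      = (R.coroot γ) ∘ₗ (Module.preReflection α (R.coroot α)) := by
    refine Module.Dual.eq_of_preReflection_mapsTo (x := γ - R.coroot α γ • α)
      R.finite R.span_eq (aux_self R hm hn) ?_ ?_ ?_
    · intro y hy
      exact aux_refl_mem R hm hn hy
    · simp only [LinearMap.comp_apply, Module.preReflection_apply]
      rw [aux_invol R hα h0, aux_self R hγ g0]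
    · intro y hy
      have h1 := aux_refl_mem R hα h0 (aux_refl_mem R hγ g0 (aux_refl_mem R hα h0 hy))
      convert h1 using 1
      simp only [LinearMap.comp_apply, Module.preReflection_apply, map_sub, map_smul,
        smul_eq_mul, aux_self R hα h0]
      module
  rw [key]; rfl

open Classical in
/-- The invariant form. -/
noncomputable def auxB (R : RootSystemIn k 𝒳) (x y : 𝒳) : k :=
  ∑ γ ∈ R.finite.toFinset.erase 0, R.coroot γ x * R.coroot γ y

theorem auxB_inv (R : RootSystemIn k 𝒳) {α : 𝒳} (hα : α ∈ R.Δ) (h0 : α ≠ 0) (x y : 𝒳) :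
    auxB R (x - R.coroot α x • α) (y - R.coroot α y • α) = auxB R x y := by
  classical
  unfold auxB
  refine Finset.sum_nbij' (fun γ => γ - R.coroot α γ • α) (fun γ => γ - R.coroot α γ • α)
    ?_ ?_ ?_ ?_ ?_
  · intro γ hγ
    simp only [Finset.mem_erase, Set.Finite.mem_toFinset] at hγ ⊢
    exact ⟨aux_refl_ne R hα h0 hγ.1, aux_refl_mem R hα h0 hγ.2⟩
  · intro γ hγ
    simp only [Finset.mem_erase, Set.Finite.mem_toFinset] at hγ ⊢
    exact ⟨aux_refl_ne R hα h0 hγ.1, aux_refl_mem R hα h0 hγ.2⟩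
  · intro γ _
    exact aux_invol R hα h0 γ
  · intro γ _
    exact aux_invol R hα h0 γ
  · intro γ hγ
    simp only [Finset.mem_erase, Set.Finite.mem_toFinset] at hγ
    rw [aux_coroot_refl R hα h0 hγ.2 hγ.1, aux_coroot_refl R hα h0 hγ.2 hγ.1]

theorem auxB_pair (R : RootSystemIn k 𝒳) {α : 𝒳} (hα : α ∈ R.Δ) (h0 : α ≠ 0) (x : 𝒳) :
    2 * auxB R x α = R.coroot α x * auxB R α α := by
  have h := auxB_inv R hα h0 x α
  rw [aux_self R hα h0] at h
  have e : auxB R (x - R.coroot α x • α) (α - (2:k) • α)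
      = - auxB R x α + R.coroot α x * auxB R α α := by
    unfold auxB
    rw [Finset.mul_sum, ← Finset.sum_neg_distrib, ← Finset.sum_add_distrib]
    refine Finset.sum_congr rfl fun γ _ => ?_
    simp only [map_sub, map_smul, smul_eq_mul]
    ring
  rw [e] at h
  linear_combination -h

theorem auxB_pos (R : RootSystemIn k 𝒳) {α : 𝒳} (hα : α ∈ R.Δ) (h0 : α ≠ 0) :
    ∃ b : ℤ, 0 < b ∧ auxB R α α = (b : k) := by
  classical
  choose! p hp using fun γ hγ g0 => R.pairing_int γ hγ g0 α hα
  refine ⟨∑ γ ∈ R.finite.toFinset.erase 0, p γ * p γ, ?_, ?_⟩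
  · refine Finset.sum_pos' (fun _ _ => mul_self_nonneg _) ⟨α, by simp [hα, h0], ?_⟩
    have : p α = 2 := by
      have := (hp α hα h0).symm.trans (aux_self R hα h0)
      exact_mod_cast this
    rw [this]; norm_num
  · unfold auxB
    push_cast
    refine Finset.sum_congr rfl fun γ hγ => ?_
    simp only [Finset.mem_erase, Set.Finite.mem_toFinset] at hγ
    rw [hp γ hγ.2 hγ.1]

theorem aux_exists_pos (R : RootSystemIn k 𝒳) (Pi : Finset 𝒳)
    (hP : (↑Pi : Set 𝒳) ⊆ R.Δ \ {0}) {β : 𝒳} (hβ : β ∈ R.Δ) (h0 : β ≠ 0) (c : 𝒳 → ℤ)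
    (hc : ∀ α ∈ Pi, 0 ≤ c α) (hs : β = ∑ α ∈ Pi, c α • α) :
    ∃ α ∈ Pi, ∃ n : ℤ, 0 < n ∧ 0 < c α ∧ R.coroot α β = (n : k) := by
  have hP' : ∀ α ∈ Pi, α ∈ R.Δ ∧ α ≠ 0 := fun α h => hP h
  choose! n hn using fun α h => R.pairing_int α (hP' α h).1 (hP' α h).2 β hβ
  choose! b hb using fun α h => auxB_pos R (hP' α h).1 (hP' α h).2
  obtain ⟨d, hd, hd'⟩ := auxB_pos R hβ h0
  by_contra! hcon
  have hk : (2 * d : ℤ) = ∑ α ∈ Pi, c α * (n α * b α) := by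
    have : ((2 * d : ℤ) : k) = ((∑ α ∈ Pi, c α * (n α * b α) : ℤ) : k) := by
      push_cast
      rw [← hd']
      have e : auxB R β β = ∑ α ∈ Pi, (c α : k) * auxB R β α := by
        unfold auxB
        simp_rw [Finset.mul_sum]
        rw [Finset.sum_comm]
        refine Finset.sum_congr rfl fun γ _ => ?_
        conv_lhs => rw [hs]
        conv_lhs => enter [1]; rw [← hs]
        rw [map_sum, Finset.mul_sum]
        refine Finset.sum_congr rfl fun α _ => ?_
        rw [map_zsmul, zsmul_eq_mul]
        ring
      rw [e, Finset.mul_sum]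
      refine Finset.sum_congr rfl fun α hα => ?_
      rw [← hn α hα, ← (hb α hα).2, ← auxB_pair R (hP' α hα).1 (hP' α hα).2]
      ring
    exact_mod_cast this
  have : ∑ α ∈ Pi, c α * (n α * b α) ≤ 0 := by
    refine Finset.sum_nonpos fun α hα => ?_
    rcases (hc α hα).lt_or_eq with h | h
    · have hnn : n α ≤ 0 := by
        by_contra! hh
        exact hcon α hα (n α) hh h (hn α hα)
      exact mul_nonpos_of_nonneg_of_nonpos h.le
        (mul_nonpos_of_nonpos_of_nonneg hnn (hb α hα).1.le)
    · simp [← h]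
  omega

/-! sl2 computations -/

theorem aux_wt (e f x : L) (n : k) (hf : ⁅⁅e, f⁆, f⁆ = (-2 : k) • f)
    (hx : ⁅⁅e, f⁆, x⁆ = n • x) (i : ℕ) :
    ⁅⁅e, f⁆, ((LieAlgebra.ad k L f) ^ i) x⁆
      = (n - 2 * i) • ((LieAlgebra.ad k L f) ^ i) x := by
  induction i with
  | zero => simpa using hx
  | succ i ih =>
    rw [pow_succ', Module.End.mul_apply, LieAlgebra.ad_apply, leibniz_lie, ih, hf]
    simp only [smul_lie, lie_smul]
    push_cast
    module

theorem aux_comm (e f x : L) (n : k) (hf : ⁅⁅e, f⁆, f⁆ = (-2 : k) • f)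
    (hx : ⁅⁅e, f⁆, x⁆ = n • x) (i : ℕ) :
    ⁅e, ((LieAlgebra.ad k L f) ^ (i+1)) x⁆
      = ((LieAlgebra.ad k L f) ^ (i+1)) ⁅e, x⁆
        + (((i : k) + 1) * (n - i)) • ((LieAlgebra.ad k L f) ^ i) x := by
  induction i with
  | zero =>
    simp only [zero_add, pow_one, LieAlgebra.ad_apply, pow_zero, Module.End.one_apply]
    rw [leibniz_lie, hx]
    push_cast
    module
  | succ i ih =>
    rw [pow_succ' _ (i+1), Module.End.mul_apply, LieAlgebra.ad_apply, leibniz_lie, ih,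
      aux_wt e f x n hf hx, lie_add, lie_smul, Module.End.mul_apply, LieAlgebra.ad_apply]
    have h2 : ⁅f, ((LieAlgebra.ad k L f) ^ i) x⁆ = ((LieAlgebra.ad k L f) ^ (i+1)) x := by
      rw [pow_succ', Module.End.mul_apply, LieAlgebra.ad_apply]
    rw [h2]
    push_cast
    module

theorem aux_prim (e f x : L) (n : ℕ) (hf : ⁅⁅e, f⁆, f⁆ = (-2 : k) • f)
    (hx : ⁅⁅e, f⁆, x⁆ = (n : k) • x) (hex : ⁅e, x⁆ = 0) (i : ℕ) (hi : i ≤ n)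
    (hz : ((LieAlgebra.ad k L f) ^ i) x = 0) : x = 0 := by
  induction i with
  | zero => simpa using hz
  | succ i ih =>
    have h := aux_comm e f x (n : k) hf hx i
    rw [hz, hex, lie_zero, map_zero, zero_add] at h
    refine ih (by omega) ?_
    refine (smul_eq_zero.mp h.symm).resolve_left (mul_ne_zero ?_ ?_)
    · exact_mod_cast Nat.succ_ne_zero i
    · rw [sub_ne_zero]
      exact_mod_cast (by omega : n ≠ i)

theorem aux_inj (e f : L) (he : ⁅⁅e, f⁆, e⁆ = (2 : k) • e)
    (hf : ⁅⁅e, f⁆, f⁆ = (-2 : k) • f) (m : ℕ) : ∀ (x : L) (n : ℕ),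
    ⁅⁅e, f⁆, x⁆ = (n : k) • x → ((LieAlgebra.ad k L e) ^ m) x = 0 →
    ((LieAlgebra.ad k L f) ^ n) x = 0 → x = 0 := by
  induction m with
  | zero => intro x n _ h _; simpa using h
  | succ m ih =>
    intro x n hx hm hz
    refine aux_prim e f x n hf hx ?_ n le_rfl hz
    have hz1 : ((LieAlgebra.ad k L f) ^ (n+1)) x = 0 := by
      rw [pow_succ', Module.End.mul_apply, hz, map_zero]
    have hz2 : ((LieAlgebra.ad k L f) ^ (n+2)) x = 0 := by
      rw [pow_succ', Module.End.mul_apply, hz1, map_zero]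
    refine ih ⁅e, x⁆ (n+2) ?_ ?_ ?_
    · rw [leibniz_lie, hx, he, smul_lie, lie_smul]
      push_cast
      module
    · rw [pow_succ, Module.End.mul_apply, LieAlgebra.ad_apply] at hm
      exact hm
    · have h := aux_comm e f x (n : k) hf hx (n+1)
      rw [hz2, hz1, lie_zero, smul_zero, add_zero] at h
      exact h.symm

theorem aux_ad_mem (R : RootSystemIn k 𝒳) (g : 𝒳 → Λ → Submodule k L)
    (hLT : IsLieTorus R g) {α β : 𝒳} {lam mu : Λ} {e x : L} (he : e ∈ g α lam)
    (hx : x ∈ g β mu) (i : ℕ) :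
    ((LieAlgebra.ad k L e) ^ i) x ∈ g (β + i • α) (mu + i • lam) := by
  induction i with
  | zero => simpa using hx
  | succ i ih =>
    rw [pow_succ', Module.End.mul_apply, LieAlgebra.ad_apply]
    have := hLT.bracket_mem _ _ _ _ _ he _ ih
    convert this using 1
    congr 1 <;> rw [succ_nsmul] <;> abel

theorem aux_ad_nil (R : RootSystemIn k 𝒳) (g : 𝒳 → Λ → Submodule k L)
    (hLT : IsLieTorus R g) {α β : 𝒳} {lam mu : Λ} {e x : L} (h0 : α ≠ 0)
    (he : e ∈ g α lam) (hx : x ∈ g β mu) :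
    ∃ i : ℕ, ((LieAlgebra.ad k L e) ^ i) x = 0 := by
  by_contra! hcon
  have hmem : ∀ i : ℕ, β + i • α ∈ R.Δ := by
    intro i
    refine hLT.supp_subset _ (mu + i • lam) fun hb => hcon i ?_
    have := aux_ad_mem R g hLT he hx i
    rw [hb] at this
    simpa using this
  have hinj : Function.Injective fun i : ℕ => β + i • α := by
    intro i j hij
    have h1 : (i : k) • α = (j : k) • α := by
      rw [Nat.cast_smul_eq_nsmul, Nat.cast_smul_eq_nsmul]
      exact add_left_cancel hij
    exact_mod_cast smul_left_injective k h0 h1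
  exact Set.infinite_of_injective_forall_mem hinj hmem R.finite

theorem aux_neg_supp (R : RootSystemIn k 𝒳) (g : 𝒳 → Λ → Submodule k L)
    (hLT : IsLieTorus R g) {α : 𝒳} {lam : Λ} (h0 : α ≠ 0) (h : g α lam ≠ ⊥) :
    g (-α) (-lam) ≠ ⊥ := by
  obtain ⟨e, f, he, hf, hes, hfs, hh⟩ := hLT.lt2ii α lam h0 h
  intro hb
  have hf0 : f = 0 := by rw [hb] at hf; simpa using hf
  have := hh α lam e he
  rw [hf0, aux_self R (hLT.supp_subset _ _ h) h0] at this
  rw [lie_zero, zero_lie] at this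
  have he0 : e = 0 := (smul_eq_zero.mp this.symm).resolve_left two_ne_zero
  apply h
  rw [hes, he0]; simp

theorem aux_weyl (R : RootSystemIn k 𝒳) (g : 𝒳 → Λ → Submodule k L)
    (hLT : IsLieTorus R g) {α β : 𝒳} {lam mu : Λ} (h0 : α ≠ 0) (h : g α lam ≠ ⊥)
    (hb : g β mu ≠ ⊥) (n : ℤ) (hn : R.coroot α β = (n : k)) :
    g (β - n • α) (mu - n • lam) ≠ ⊥ := by
  obtain ⟨e, f, he, hf, hes, hfs, hh⟩ := hLT.lt2ii α lam h0 h
  obtain ⟨x, hx, hx0⟩ := Submodule.exists_mem_ne_zero_of_ne_bot hb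
  have hself := aux_self R (hLT.supp_subset _ _ h) h0
  have hhe : ⁅⁅e, f⁆, e⁆ = (2 : k) • e := by rw [hh α lam e he, hself]
  have hhf : ⁅⁅e, f⁆, f⁆ = (-2 : k) • f := by rw [hh _ _ f hf, map_neg, hself]
  have hhx : ⁅⁅e, f⁆, x⁆ = (n : k) • x := by rw [hh _ _ x hx, hn]
  rcases Int.eq_nat_or_neg n with ⟨m, rfl | rfl⟩
  · obtain ⟨i, hi⟩ := aux_ad_nil R g hLT h0 he hx
    intro hbot
    apply hx0
    refine aux_inj e f hhe hhf i x m (by simpa using hhx) hi ?_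
    have := aux_ad_mem R g hLT hf hx m
    have e1 : g (β + m • -α) (mu + m • -lam) = ⊥ := by
      rw [← hbot]; congr 1 <;> simp [sub_eq_add_neg]
    rw [e1] at this
    simpa using this
  · obtain ⟨i, hi⟩ := aux_ad_nil R g hLT (neg_ne_zero.mpr h0) hf hx
    intro hbot
    apply hx0
    have hsw : ⁅f, e⁆ = -⁅e, f⁆ := (lie_skew f e).symm
    refine aux_inj f e ?_ ?_ i x m ?_ hi ?_
    · rw [hsw, neg_lie, hhf]; module
    · rw [hsw, neg_lie, hhe]; module
    · rw [hsw, neg_lie, hhx]; push_cast; module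
    have := aux_ad_mem R g hLT he hx m
    have e1 : g (β + m • α) (mu + m • lam) = ⊥ := by
      rw [← hbot]; congr 1 <;> simp [sub_eq_add_neg]
    rw [e1] at this
    simpa using this

/-- extension of `s` by zero -/
noncomputable def auxT (R : RootSystemIn k 𝒳) (s : ↥(AddSubgroup.closure R.Δ) →+ Λ)
    (α : 𝒳) : Λ := by
  classical
  exact if h : α ∈ AddSubgroup.closure R.Δ then s ⟨α, h⟩ else 0

theorem auxT_eq (R : RootSystemIn k 𝒳) (s : ↥(AddSubgroup.closure R.Δ) →+ Λ)
    {α : 𝒳} (h : α ∈ AddSubgroup.closure R.Δ) : s ⟨α, h⟩ = auxT R s α := by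
  simp [auxT, h]

theorem auxT_add (R : RootSystemIn k 𝒳) (s : ↥(AddSubgroup.closure R.Δ) →+ Λ)
    {α β : 𝒳} (h : α ∈ AddSubgroup.closure R.Δ) (h' : β ∈ AddSubgroup.closure R.Δ) :
    auxT R s (α + β) = auxT R s α + auxT R s β := by
  rw [← auxT_eq R s h, ← auxT_eq R s h', ← auxT_eq R s (add_mem h h'), ← map_add]
  rfl

theorem auxT_neg (R : RootSystemIn k 𝒳) (s : ↥(AddSubgroup.closure R.Δ) →+ Λ)
    {α : 𝒳} (h : α ∈ AddSubgroup.closure R.Δ) :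
    auxT R s (-α) = - auxT R s α := by
  rw [← auxT_eq R s h, ← auxT_eq R s (neg_mem h), ← map_neg]
  rfl

theorem auxT_zsmul (R : RootSystemIn k 𝒳) (s : ↥(AddSubgroup.closure R.Δ) →+ Λ)
    {α : 𝒳} (h : α ∈ AddSubgroup.closure R.Δ) (n : ℤ) :
    auxT R s (n • α) = n • auxT R s α := by
  rw [← auxT_eq R s h, ← auxT_eq R s (zsmul_mem h n), ← map_zsmul]
  rfl

theorem aux_iso_eq (R : RootSystemIn k 𝒳) (g : 𝒳 → Λ → Submodule k L)
    (hLT : IsLieTorus R g) (s : ↥(AddSubgroup.closure R.Δ) →+ Λ) :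
    isoGrading R g s = fun α lam => g α (lam + auxT R s α) := by
  funext α lam
  unfold isoGrading
  split_ifs with h
  · rw [auxT_eq]
  · symm
    by_contra hb
    exact h (AddSubgroup.subset_closure (hLT.supp_subset _ _ hb))

theorem aux_isotope (R : RootSystemIn k 𝒳) (g : 𝒳 → Λ → Submodule k L)
    (hLT : IsLieTorus R g) (s : ↥(AddSubgroup.closure R.Δ) →+ Λ)
    (hs : Admissible R g s) : IsLieTorus R (isoGrading R g s) := by
  rw [aux_iso_eq R g hLT s]
  have hmem : ∀ α lam, g α lam ≠ ⊥ → α ∈ AddSubgroup.closure R.Δ :=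
    fun α lam h => AddSubgroup.subset_closure (hLT.supp_subset _ _ h)
  refine ⟨?_, ?_, ?_, ?_, ?_, ?_, ?_⟩
  · let E : 𝒳 × Λ ≃ 𝒳 × Λ :=
      { toFun := fun p => (p.1, p.2 + auxT R s p.1)
        invFun := fun p => (p.1, p.2 - auxT R s p.1)
        left_inv := fun p => by simp
        right_inv := fun p => by simp }
    have h := hLT.isInternal
    rw [DirectSum.isInternal_submodule_iff_iSupIndep_and_iSup_eq_top] at h ⊢
    refine ⟨h.1.comp E.injective, ?_⟩
    rw [← h.2]
    exact E.iSup_comp (g := fun p : 𝒳 × Λ => g p.1 p.2)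
  · intro α β lam mu x hx y hy
    by_cases ha : g α (lam + auxT R s α) = ⊥
    · have : x = 0 := by simpa [ha] using hx
      rw [this, zero_lie]; exact zero_mem _
    by_cases hb : g β (mu + auxT R s β) = ⊥
    · have : y = 0 := by simpa [hb] using hy
      rw [this, lie_zero]; exact zero_mem _
    have := hLT.bracket_mem _ _ _ _ x hx y hy
    convert this using 1
    rw [auxT_add R s (hmem _ _ ha) (hmem _ _ hb)]
    congr 1
    abel
  · intro α lam h
    exact hLT.supp_subset _ _ h
  · intro α hα h0 hi
    have := hs α hα h0 hi
    rw [auxT_eq] at this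
    simpa using this
  · intro α lam h0 h
    obtain ⟨e, f, he, hf, hes, hfs, hh⟩ := hLT.lt2ii α _ h0 h
    have e1 : -lam + auxT R s (-α) = -(lam + auxT R s α) := by
      rw [auxT_neg R s (hmem _ _ h)]; abel
    refine ⟨e, f, he, ?_, hes, ?_, fun β mu x hx => hh β _ x hx⟩
    · simpa only [e1] using hf
    · simpa only [e1] using hfs
  · rw [← hLT.lt3]
    congr 1
    refine Set.iUnion₂_congr fun α _ => ?_
    exact (Equiv.addRight (auxT R s α)).surjective.iUnion_comp (fun lam => (g α lam : Set L))
  · set M := AddSubgroup.closure {lam : Λ | ∃ α : 𝒳, g α (lam + auxT R s α) ≠ ⊥} with hM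
    have h1 : ∀ α ∈ R.Δ, α ≠ 0 → (¬ ∃ γ ∈ R.Δ, α = (2 : k) • γ) → auxT R s α ∈ M := by
      intro α hα h0 hi
      rw [← neg_mem_iff]
      refine AddSubgroup.subset_closure ⟨α, ?_⟩
      rw [neg_add_cancel]
      exact hLT.lt2i α hα h0 hi
    have hz : auxT R s 0 = 0 := by
      have := auxT_zsmul R s (zero_mem (AddSubgroup.closure R.Δ)) 0
      simpa using this
    have h2 : ∀ α ∈ R.Δ, auxT R s α ∈ M := by
      intro α hα
      by_cases h0 : α = 0
      · rw [h0, hz]; exact zero_mem _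
      by_cases hi : ∃ γ ∈ R.Δ, α = (2 : k) • γ
      · obtain ⟨γ, hγ, rfl⟩ := hi
        have g0 : γ ≠ 0 := by rintro rfl; simp at h0
        have hg : auxT R s γ ∈ M := by
          refine h1 γ hγ g0 ?_
          rintro ⟨δ, hδ, rfl⟩
          obtain ⟨z, hz⟩ := R.pairing_int _ hα h0 δ hδ
          have := aux_self R hα h0
          rw [map_smul, map_smul, hz, smul_eq_mul, smul_eq_mul] at this
          have h3 : (2 * (2 * z) : ℤ) = 2 := by exact_mod_cast this
          omega
        rw [two_smul, auxT_add R s (AddSubgroup.subset_closure hγ)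
          (AddSubgroup.subset_closure hγ)]
        exact add_mem hg hg
      · exact h1 α hα h0 hi
    rw [eq_top_iff, ← hLT.lt4, AddSubgroup.closure_le]
    rintro lam ⟨α, h⟩
    have h3 : lam - auxT R s α ∈ M := by
      refine AddSubgroup.subset_closure ⟨α, ?_⟩
      rwa [sub_add_cancel]
    have := add_mem h3 (h2 α (hLT.supp_subset _ _ h))
    rwa [sub_add_cancel] at this

theorem aux_coeff (Pi : Finset 𝒳)
    (hl : LinearIndependent k (fun x : (Pi : Set 𝒳) => (x : 𝒳))) (c d : 𝒳 → ℤ)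
    (h : ∑ α ∈ Pi, c α • α = ∑ α ∈ Pi, d α • α) : ∀ α ∈ Pi, c α = d α := by
  have hl' : LinearIndepOn k id (Pi : Set 𝒳) := hl
  rw [linearIndepOn_finset_iff] at hl'
  intro α hα
  have := hl' (fun a => ((c a - d a : ℤ) : k)) ?_ α hα
  · have h2 : c α - d α = 0 := by exact_mod_cast this
    omega
  · simp only [id, Int.cast_smul_eq_zsmul, sub_smul, Finset.sum_sub_distrib, h, sub_self]

theorem aux_pos (R : RootSystemIn k 𝒳) (g : 𝒳 → Λ → Submodule k L)
    (hLT : IsLieTorus R g) (s : ↥(AddSubgroup.closure R.Δ) →+ Λ)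
    (Pi : Finset 𝒳) (hPi : IsBase R Pi) (hs : ∀ α ∈ Pi, g α (auxT R s α) ≠ ⊥) (N : ℕ) :
    ∀ β ∈ R.Δ, β ≠ 0 → (¬ ∃ γ ∈ R.Δ, β = (2 : k) • γ) → ∀ c : 𝒳 → ℤ,
      (∀ α ∈ Pi, 0 ≤ c α) → β = ∑ α ∈ Pi, c α • α → ∑ α ∈ Pi, c α ≤ N →
      g β (auxT R s β) ≠ ⊥ := by
  induction N with
  | zero =>
    intro β hβ h0 hi c hc hb hle
    exfalso
    apply h0
    rw [hb]
    refine Finset.sum_eq_zero fun α hα => ?_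
    have h1 : ∑ α ∈ Pi, c α = 0 := le_antisymm (by simpa using hle) (Finset.sum_nonneg hc)
    rw [(Finset.sum_eq_zero_iff_of_nonneg hc).mp h1 α hα, zero_smul]
  | succ N ih =>
    intro β hβ h0 hi c hc hb hle
    by_cases hbP : β ∈ Pi
    · exact hs β hbP
    obtain ⟨α, hα, n, hn, hcα, hpair⟩ := aux_exists_pos R Pi hPi.1 hβ h0 c hc hb
    have hαΔ : α ∈ R.Δ := (hPi.1 hα).1
    have hα0 : α ≠ 0 := (hPi.1 hα).2
    -- another simple root occurs in `β`
    have hother : ∃ δ ∈ Pi, δ ≠ α ∧ 0 < c δ := by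
      by_contra! hcon
      have hb2 : β = c α • α := by
        rw [hb]
        refine Finset.sum_eq_single_of_mem α hα fun δ hδ hne => ?_
        rw [le_antisymm (hcon δ hδ hne) (hc δ hδ), zero_smul]
      obtain ⟨z, hz⟩ := R.pairing_int β hβ h0 α hαΔ
      have h2 := aux_self R hβ h0
      have h3 : R.coroot β (c α • α) = 2 := by rw [← hb2]; exact h2
      rw [map_zsmul, hz, zsmul_eq_mul] at h3
      have h4 : c α * z = 2 := by exact_mod_cast h3
      have h5 : c α ∣ 2 := ⟨z, h4.symm⟩
      have h6 := Int.le_of_dvd (by norm_num) h5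
      have h7 : c α = 1 ∨ c α = 2 := by omega
      rcases h7 with h7 | h7
      · rw [h7, one_smul] at hb2
        exact hbP (hb2 ▸ hα)
      · refine hi ⟨α, hαΔ, ?_⟩
        rw [hb2, h7, two_smul, two_smul]
    obtain ⟨δ, hδ, hδα, hcδ⟩ := hother
    have hm := aux_refl_mem R hαΔ hα0 hβ
    have hne := aux_refl_ne R hαΔ hα0 h0
    have hinv := aux_invol R hαΔ hα0 β
    have hsm : β - R.coroot α β • α = β - n • α := by
      rw [hpair, Int.cast_smul_eq_zsmul]
    have hpair' : R.coroot α (β - n • α) = ((-n : ℤ) : k) := by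
      rw [map_sub, map_zsmul, aux_self R hαΔ hα0, hpair, zsmul_eq_mul]
      push_cast; ring
    rw [hsm] at hm hne
    have hi' : ¬ ∃ γ ∈ R.Δ, β - n • α = (2 : k) • γ := by
      rintro ⟨γ, hγ, hγe⟩
      refine hi ⟨_, aux_refl_mem R hαΔ hα0 hγ, ?_⟩
      rw [← hinv, hsm, hγe, map_smul]
      module
    let c' : 𝒳 → ℤ := fun a => c a - if a = α then n else 0
    have hb' : β - n • α = ∑ a ∈ Pi, c' a • a := by
      simp only [c', sub_smul, Finset.sum_sub_distrib, ite_smul, zero_smul,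
        Finset.sum_ite_eq', hα, if_true]
      rw [← hb]
    have hsum' : ∑ a ∈ Pi, c' a = ∑ a ∈ Pi, c a - n := by
      simp only [c', Finset.sum_sub_distrib, Finset.sum_ite_eq', hα, if_true]
    obtain ⟨d, hd, hde⟩ := hPi.2.2 _ hm
    have hcd := aux_coeff Pi hPi.2.1 c' d (hb'.symm.trans hde)
    have hc' : ∀ a ∈ Pi, 0 ≤ c' a := by
      rcases hd with hd | hd
      · intro a ha; rw [hcd a ha]; exact hd a ha
      · exfalso
        have h1 := hd δ hδ
        rw [← hcd δ hδ] at h1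
        simp only [c', hδα, if_false] at h1
        omega
    have key := ih _ hm hne hi' c' hc' hb' (by push_cast at hle; omega)
    have hw := aux_weyl R g hLT hα0 (hs α hα) key (-n) hpair'
    have hαQ : α ∈ AddSubgroup.closure R.Δ := AddSubgroup.subset_closure hαΔ
    have hmQ : β - n • α ∈ AddSubgroup.closure R.Δ := AddSubgroup.subset_closure hm
    have e1 : β - n • α - -n • α = β := by module
    have e2 : auxT R s (β - n • α) - -n • auxT R s α = auxT R s β := by
      rw [neg_smul, sub_neg_eq_add, ← auxT_zsmul R s hαQ, ← auxT_add R s hmQ (zsmul_mem hαQ n),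
        sub_add_cancel]
    rwa [e1, e2] at hw

theorem aux_adm (R : RootSystemIn k 𝒳) (g : 𝒳 → Λ → Submodule k L)
    (hLT : IsLieTorus R g) (s : ↥(AddSubgroup.closure R.Δ) →+ Λ)
    (Pi : Finset 𝒳) (hPi : IsBase R Pi) (hs : ∀ α ∈ Pi, g α (auxT R s α) ≠ ⊥) :
    Admissible R g s := by
  intro β hβ h0 hi
  rw [auxT_eq]
  obtain ⟨c, hc | hc, hb⟩ := hPi.2.2 β hβ
  · exact aux_pos R g hLT s Pi hPi hs (∑ α ∈ Pi, c α).toNat β hβ h0 hi c hc hb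
      (Int.self_le_toNat _)
  · have hneg := aux_neg_mem R hβ h0
    have h := aux_pos R g hLT s Pi hPi hs (∑ α ∈ Pi, -c α).toNat (-β) hneg
      (neg_ne_zero.mpr h0) ?_ (fun a => -c a) (fun a ha => by have := hc a ha; simpa using this)
      ?_ (Int.self_le_toNat _)
    · have h2 := aux_neg_supp R g hLT (neg_ne_zero.mpr h0) h
      rwa [auxT_neg R s (AddSubgroup.subset_closure hβ), neg_neg, neg_neg] at h2
    · rintro ⟨γ, hγ, hγe⟩
      have g0 : γ ≠ 0 := by
        rintro rfl
        rw [smul_zero, neg_eq_zero] at hγe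
        exact h0 hγe
      refine hi ⟨-γ, aux_neg_mem R hγ g0, ?_⟩
      rw [smul_neg, ← hγe, neg_neg]
    · simp only [neg_smul, Finset.sum_neg_distrib]
      rw [← hb]

theorem aux_base_indiv (R : RootSystemIn k 𝒳) (Pi : Finset 𝒳) (hPi : IsBase R Pi)
    {α : 𝒳} (hα : α ∈ Pi) : ¬ ∃ γ ∈ R.Δ, α = (2 : k) • γ := by
  rintro ⟨γ, hγ, he⟩
  obtain ⟨c, -, hc⟩ := hPi.2.2 γ hγ
  have h1 : ∑ a ∈ Pi, (if a = α then (1:ℤ) else 0) • a = ∑ a ∈ Pi, (2 * c a) • a := by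
    simp only [ite_smul, one_smul, zero_smul, Finset.sum_ite_eq', hα, if_true, mul_smul]
    rw [← Finset.smul_sum, ← hc]
    conv_lhs => rw [he]
    rw [two_smul, two_smul]
  have := aux_coeff Pi hPi.2.1 _ _ h1 α hα
  simp only [if_true] at this
  omega

/-- For a Lie `Λ`-torus `L` of type `Δ`, `s ∈ Hom(Q, Λ)` and a base `Π` of `Δ`, the
following are equivalent: (a) the isotope `L^(s)` is again a Lie torus; (b) `s(α) ∈ Λ_α`
for every indivisible nonzero root `α`; (c) `s(α) ∈ Λ_α` for every `α ∈ Π`. -/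
theorem stmt15 (R : RootSystemIn k 𝒳) (g : 𝒳 → Λ → Submodule k L)
    (hLT : IsLieTorus R g) (s : ↥(AddSubgroup.closure R.Δ) →+ Λ)
    (Pi : Finset 𝒳) (hPi : IsBase R Pi) :
    (IsLieTorus R (isoGrading R g s) ↔ Admissible R g s) ∧
    (Admissible R g s ↔
      ∀ α, ∀ hα : α ∈ Pi,
        g α (s ⟨α, AddSubgroup.subset_closure
          (hPi.1 (Finset.mem_coe.mpr hα)).1⟩) ≠ ⊥) := by
  refine ⟨⟨fun h => ?_, aux_isotope R g hLT s⟩, ⟨fun h α hα => ?_, fun h => ?_⟩⟩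
  · intro α hα h0 hi
    have := h.lt2i α hα h0 hi
    rw [aux_iso_eq R g hLT s] at this
    rw [auxT_eq]
    simpa using this
  · exact h α (hPi.1 (Finset.mem_coe.mpr hα)).1 (hPi.1 (Finset.mem_coe.mpr hα)).2 (aux_base_indiv R Pi hPi hα)
  · refine aux_adm R g hLT s Pi hPi fun α hα => ?_
    have := h α hα
    rwa [auxT_eq] at this

end
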